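/- Epstein–Zin explicit solution, case of large wealth: assume τ̄ > 0, where τ̄ = T − (1/(δ+β(1−1/α))) ln((r+β)/(r+β/α−δ)) if δ+β(1−1/α) ≠ 0 and τ̄ = T − 1/(r+β) otherwise. Let k* = ((r+β/α−δ)/(β(δ−(1−1/α)r)))(1 − e^{−[αδ+(1−α)r]τ̄}) if δ ≠ (1−1/α)r, and k* = (1 − α(δ−r)/β)τ̄ otherwise. If w ≥ k*·y, then the consumption plan consisting of an initial gulp ΔC₀ = (w − k*y)/(1+βk*) at time 0, consumption at rates dC_t = (1 − α(δ−r)/β)·((y+βw)/(1+βk*))·e^{−α(δ−r)t} dt for t∈(0,τ̄], and no consumption on (τ̄,T], is the optimal plan for sup_{C∈A(w)} U^C_0. -/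

import Mathlib

open MeasureTheory Set Filter

noncomputable section

/-- A consumption plan on `[0,T]`, identified with the finite measure `dC` it induces on
`[0,T]` (including a possible point mass at `0`, corresponding to `C_{0-} = 0`).
The cumulative consumption function is `t ↦ (μ (Icc 0 t)).toReal`, which is automatically
nonnegative, nondecreasing and right-continuous. -/
structure ConsumptionPlan (T : ℝ) where
  μ : Measure ℝ
  fin : IsFiniteMeasure μ
  supp : μ (Set.Icc 0 T)ᶜ = 0

/-- The cumulative consumption `C_t`. -/
def ConsumptionPlan.val {T : ℝ} (C : ConsumptionPlan T) (t : ℝ) : ℝ :=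
  (C.μ (Set.Icc 0 t)).toReal

/-- The level of satisfaction `Y^C_t = η_t + ∫_0^t θ(t,s) dC_s` (integral over `[0,t]`). -/
def satisfaction (η : ℝ → ℝ) (θ : ℝ → ℝ → ℝ) {T : ℝ} (C : ConsumptionPlan T) (t : ℝ) : ℝ :=
  η t + ∫ s in Set.Icc 0 t, θ t s ∂C.μ

/-- `U` is a (continuous) recursive utility for satisfaction level `Y`:
`U_t = ∫_t^T f(s, Y_s, U_s) ds` on `[0,T]`. -/
def IsRecursiveUtility (T : ℝ) (f : ℝ → ℝ → ℝ → ℝ) (Y U : ℝ → ℝ) : Prop :=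
  ContinuousOn U (Set.Icc 0 T) ∧ ∀ t ∈ Set.Icc 0 T, U t = ∫ s in t..T, f s (Y s) (U s)

/-- Assumption A1 on the intertemporal aggregator `f`. -/
structure AssumptionA1 (T : ℝ) (f : ℝ → ℝ → ℝ → ℝ) : Prop where
  strictConcave : ∀ s ∈ Set.Icc 0 T,
    StrictConcaveOn ℝ (Set.Ici 0 ×ˢ (Set.univ : Set ℝ)) (fun p : ℝ × ℝ => f s p.1 p.2)
  contDiff : ∀ s ∈ Set.Icc 0 T,
    ContDiffOn ℝ 1 (fun p : ℝ × ℝ => f s p.1 p.2) (Set.Ici 0 ×ˢ (Set.univ : Set ℝ))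
  strictMono : ∀ s ∈ Set.Icc 0 T, ∀ u : ℝ, StrictMonoOn (fun y => f s y u) (Set.Ici 0)
  lipschitz : ∃ K > 0, ∀ s ∈ Set.Icc 0 T, ∀ y ∈ Set.Ici (0 : ℝ), ∀ u u' : ℝ,
    |f s y u - f s y u'| ≤ K * |u - u'|
  growth : ∃ α ∈ Set.Ioo (0 : ℝ) 1, ∃ K > 0, ∀ s ∈ Set.Icc 0 T, ∀ y ∈ Set.Ici (0 : ℝ),
    |f s y 0| ≤ K * (1 + |y| ^ α)

/-- The budget set `A(w)`: plans whose cost `∫_0^T ψ_t dC_t` is at most `w`. -/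
def InBudget {T : ℝ} (w : ℝ) (ψ : ℝ → ℝ) (C : ConsumptionPlan T) : Prop :=
  (∫ t in Set.Icc 0 T, ψ t ∂C.μ) ≤ w

/-- Partial derivative `∂_y f`. -/
def fy (f : ℝ → ℝ → ℝ → ℝ) (t y u : ℝ) : ℝ := deriv (fun y' => f t y' u) y

/-- Partial derivative `∂_u f`. -/
def fu (f : ℝ → ℝ → ℝ → ℝ) (t y u : ℝ) : ℝ := deriv (fun u' => f t y u') u

/-- Partial derivative `∂_{ty} f`. -/
def fty (f : ℝ → ℝ → ℝ → ℝ) (t y u : ℝ) : ℝ := deriv (fun t' => fy f t' y u) t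

/-- Partial derivative `∂²_{yy} f`. -/
def fyy (f : ℝ → ℝ → ℝ → ℝ) (t y u : ℝ) : ℝ := deriv (fun y' => fy f t y' u) y

/-- Partial derivative `∂_{uy} f`. -/
def fuy (f : ℝ → ℝ → ℝ → ℝ) (t y u : ℝ) : ℝ := deriv (fun u' => fy f t y u') u

/-- The differential operator
`𝔏f = r ∂_y f + ∂_u f · ∂_y f + ∂_{ty} f − β y ∂²_{yy} f − f · ∂_{uy} f`. -/
def Lop (f : ℝ → ℝ → ℝ → ℝ) (r β : ℝ) (t y u : ℝ) : ℝ :=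
  r * fy f t y u + fu f t y u * fy f t y u + fty f t y u -
    β * y * fyy f t y u - f t y u * fuy f t y u

/-- The level of satisfaction under Assumption A5.1:
`Y^C_t = y e^{−βt} + β ∫_0^t e^{−β(t−s)} dC_s`. -/
def satisfactionExp {T : ℝ} (y β : ℝ) (C : ConsumptionPlan T) (t : ℝ) : ℝ :=
  y * Real.exp (-β * t) + β * ∫ s in Set.Icc 0 t, Real.exp (-β * (t - s)) ∂C.μ

/-- Assumption A5.1 (the parts concerning the aggregator `f`): `f` and its relevant first
and second partial derivatives are continuous on `[0,T] × (0,∞) × ℝ`, the Inada-type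
conditions hold for `∂_y f`, and `𝔏f > 0` there. -/
structure AssumptionA51 (T r β : ℝ) (f : ℝ → ℝ → ℝ → ℝ) : Prop where
  cont_f : ContinuousOn (fun p : ℝ × ℝ × ℝ => f p.1 p.2.1 p.2.2)
    (Set.Icc 0 T ×ˢ Set.Ioi 0 ×ˢ (Set.univ : Set ℝ))
  cont_fy : ContinuousOn (fun p : ℝ × ℝ × ℝ => fy f p.1 p.2.1 p.2.2)
    (Set.Icc 0 T ×ˢ Set.Ioi 0 ×ˢ (Set.univ : Set ℝ))
  cont_fu : ContinuousOn (fun p : ℝ × ℝ × ℝ => fu f p.1 p.2.1 p.2.2)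
    (Set.Icc 0 T ×ˢ Set.Ioi 0 ×ˢ (Set.univ : Set ℝ))
  cont_fty : ContinuousOn (fun p : ℝ × ℝ × ℝ => fty f p.1 p.2.1 p.2.2)
    (Set.Icc 0 T ×ˢ Set.Ioi 0 ×ˢ (Set.univ : Set ℝ))
  cont_fyy : ContinuousOn (fun p : ℝ × ℝ × ℝ => fyy f p.1 p.2.1 p.2.2)
    (Set.Icc 0 T ×ˢ Set.Ioi 0 ×ˢ (Set.univ : Set ℝ))
  cont_fuy : ContinuousOn (fun p : ℝ × ℝ × ℝ => fuy f p.1 p.2.1 p.2.2)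
    (Set.Icc 0 T ×ˢ Set.Ioi 0 ×ˢ (Set.univ : Set ℝ))
  inada_zero : ∀ t ∈ Set.Icc 0 T, ∀ u : ℝ,
    Filter.Tendsto (fun y => fy f t y u) (nhdsWithin 0 (Set.Ioi 0)) Filter.atTop
  inada_infty : ∀ t ∈ Set.Icc 0 T, ∀ u : ℝ,
    Filter.Tendsto (fun y => fy f t y u) Filter.atTop (nhds 0)
  Lpos : ∀ t ∈ Set.Icc 0 T, ∀ y ∈ Set.Ioi (0 : ℝ), ∀ u : ℝ, 0 < Lop f r β t y u

/-- The function `φ*` (resp. `Φ^M/β`, up to the factor pattern of the paper):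
`t ↦ e^{(r+β)t} ∫_t^T exp(∫_0^s ∂_u f(r',Y_{r'},U_{r'}) dr') ∂_y f(s,Y_s,U_s) β e^{−βs} ds`. -/
def PhiFun (T r β : ℝ) (f : ℝ → ℝ → ℝ → ℝ) (Y U : ℝ → ℝ) (t : ℝ) : ℝ :=
  Real.exp ((r + β) * t) *
    ∫ s in t..T,
      Real.exp (∫ r' in (0:ℝ)..s, fu f r' (Y r') (U r')) *
        fy f s (Y s) (U s) * (β * Real.exp (-β * s))

/-- The (topological) support of a measure on `ℝ`. -/
def measSupport (μ : Measure ℝ) : Set ℝ :=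
  {x : ℝ | ∀ u : Set ℝ, IsOpen u → x ∈ u → 0 < μ u}
open scoped Classical

/-- The time `τ̄` at which consumption optimally stops. -/
def tauBar (T r β δ α : ℝ) : ℝ :=
  if δ + β * (1 - 1/α) ≠ 0 then
    T - (1 / (δ + β * (1 - 1/α))) * Real.log ((r + β) / (r + β/α - δ))
  else T - 1 / (r + β)

/-- The critical wealth-to-satisfaction ratio `k*`. -/
def kStar (T r β δ α : ℝ) : ℝ :=
  if δ ≠ (1 - 1/α) * r then
    ((r + β/α - δ) / (β * (δ - (1 - 1/α) * r))) *
      (1 - Real.exp (-(α * δ + (1 - α) * r) * tauBar T r β δ α))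
  else (1 - α * (δ - r) / β) * tauBar T r β δ α

/-- The Epstein–Zin recursive utility, given explicitly by
`U^C_t = (1/(1−ρ)) (∫_t^T δ e^{δ(t−s)} (Y^C_s)^{1−1/α} ds)^{ψ̂}` with
`ψ̂ = (1−ρ)/(1−1/α)`. -/
def ezUtility (T δ α ρ y β : ℝ) {T' : ℝ} (C : ConsumptionPlan T') (t : ℝ) : ℝ :=
  (1 / (1 - ρ)) *
    (∫ s in t..T, δ * Real.exp (δ * (t - s)) * (satisfactionExp y β C s) ^ (1 - 1/α)) ^
      ((1 - ρ) / (1 - 1/α))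

theorem integral_exp_const_mul {c : ℝ} (hc : c ≠ 0) (a b : ℝ) :
    ∫ s in a..b, Real.exp (c * s) = (Real.exp (c * b) - Real.exp (c * a)) / c := by
  rw [intervalIntegral.integral_comp_mul_left (fun x => Real.exp x) hc, integral_exp,
    smul_eq_mul, inv_mul_eq_div]

theorem tauBar_lt {T r β δ α : ℝ} (hr : 0 ≤ r) (hβ : 0 < β) (hrate : 0 < r + β/α - δ) :
    tauBar T r β δ α < T := by
  have hq : 0 < r + β := by positivity
  unfold tauBar
  split_ifs with h
  · have : 0 < (1 / (δ + β * (1 - 1/α))) * Real.log ((r + β) / (r + β/α - δ)) := by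
      rcases lt_or_gt_of_ne h with h' | h'
      · apply mul_pos_of_neg_of_neg (one_div_neg.mpr h')
        apply Real.log_neg (by positivity)
        rw [div_lt_one hrate]
        have : β * (1 - 1/α) = β - β/α := by ring
        linarith
      · apply mul_pos (one_div_pos.mpr h')
        apply Real.log_pos
        rw [one_lt_div hrate]
        have : β * (1 - 1/α) = β - β/α := by ring
        linarith
    linarith
  · have : 0 < 1 / (r + β) := by positivity
    linarith

theorem integral_exp_tauBar {T r β δ α : ℝ} (hr : 0 ≤ r) (hβ : 0 < β)
    (hrate : 0 < r + β/α - δ) :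
    ∫ s in (tauBar T r β δ α)..T, Real.exp (-(δ + β * (1 - 1/α)) * s) =
      Real.exp (-(δ + β * (1 - 1/α)) * tauBar T r β δ α) / (r + β) := by
  have hq : 0 < r + β := by positivity
  by_cases h : δ + β * (1 - 1/α) = 0
  · have hτ : tauBar T r β δ α = T - 1 / (r + β) := if_neg (not_not.mpr h)
    simp only [h, hτ, neg_zero, zero_mul, Real.exp_zero, intervalIntegral.integral_const,
      smul_eq_mul, mul_one]
    ring
  · rw [integral_exp_const_mul (neg_ne_zero.mpr h)]
    have hT : -(δ + β * (1 - 1/α)) * T = -(δ + β * (1 - 1/α)) * tauBar T r β δ α +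
        -Real.log ((r + β) / (r + β/α - δ)) := by
      rw [tauBar, if_pos h]
      field_simp
      ring
    have hx : r + β/α - δ = (r + β) - (δ + β * (1 - 1/α)) := by ring
    rw [hT, Real.exp_add, Real.exp_neg, Real.exp_log (by positivity), inv_div, hx]
    field_simp
    ring

theorem kStar_eq_integral {T r β δ α : ℝ} (hβ : 0 < β) (hα0 : 0 < α) :
    kStar T r β δ α = (1 - α * (δ - r) / β) *
      ∫ s in (0:ℝ)..(tauBar T r β δ α), Real.exp (-(α * δ + (1 - α) * r) * s) := by
  unfold kStar
  have hm : α * δ + (1 - α) * r = α * (δ - (1 - 1/α) * r) := by field_simp; ring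
  split_ifs with h
  · have h' : δ - (1 - 1/α) * r ≠ 0 := sub_ne_zero.mpr h
    have hm0 : -(α * δ + (1 - α) * r) ≠ 0 := by
      rw [hm]; exact neg_ne_zero.mpr (mul_ne_zero hα0.ne' h')
    rw [integral_exp_const_mul hm0]
    have hc : (r + β/α - δ) / (β * (δ - (1 - 1/α) * r)) =
        (1 - α * (δ - r) / β) / (α * δ + (1 - α) * r) := by
      rw [div_eq_div_iff (mul_ne_zero hβ.ne' h') (neg_ne_zero.mp hm0)]
      field_simp
      ring
    rw [hc, mul_zero, Real.exp_zero]
    have := neg_ne_zero.mp hm0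
    field_simp
    ring
  · push Not at h
    have : α * δ + (1 - α) * r = 0 := by rw [hm, ← h]; ring
    simp [this]

theorem rpow_div_le_add_rpow_sub_one_mul {γ a b : ℝ} (ha : 0 < a) (hb : 0 < b) (hγ0 : γ ≠ 0)
    (hγ1 : γ ≤ 1) : a ^ γ / γ ≤ b ^ γ / γ + b ^ (γ - 1) * (a - b) := by
  have key : (a / b) ^ γ / γ ≤ 1 / γ + (a / b - 1) := by
    have hx : 0 < a / b := by positivity
    rcases lt_or_gt_of_ne hγ0 with h | h
    · have h1 : 1 + γ * (a / b - 1) ≤ (a / b) ^ γ := by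
        rw [Real.rpow_def_of_pos hx]
        have := Real.add_one_le_exp (Real.log (a / b) * γ)
        have := mul_le_mul_of_nonpos_right (Real.log_le_sub_one_of_pos hx) h.le
        linarith
      rw [div_le_iff_of_neg h, add_mul, one_div, inv_mul_cancel₀ hγ0]
      linarith
    · have h1 := rpow_one_add_le_one_add_mul_self (s := a / b - 1) (p := γ)
        (by linarith) h.le hγ1
      rw [add_sub_cancel] at h1
      rw [div_le_iff₀ h, add_mul, one_div, inv_mul_cancel₀ hγ0]
      linarith
  have hbγ : 0 < b ^ γ := by positivity
  have h2 := mul_le_mul_of_nonneg_left key hbγ.le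
  rw [Real.div_rpow ha.le hb.le] at h2
  rw [Real.rpow_sub_one hb.ne']
  calc a ^ γ / γ = b ^ γ * (a ^ γ / b ^ γ / γ) := by field_simp
    _ ≤ _ := h2
    _ = _ := by field_simp

theorem one_div_mul_rpow_div_le {σ γ a b : ℝ} (ha : 0 < a) (hb : 0 < b) (hσ : σ ≠ 0)
    (hγ : γ ≠ 0) (hab : a / γ ≤ b / γ) : 1 / σ * a ^ (σ / γ) ≤ 1 / σ * b ^ (σ / γ) := by
  rcases lt_or_gt_of_ne hγ with h | h <;> rcases lt_or_gt_of_ne hσ with h' | h'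
  · have hba : b ≤ a := (div_le_div_right_of_neg h).mp hab
    exact mul_le_mul_of_nonpos_left
      (Real.rpow_le_rpow hb.le hba (div_nonneg_of_nonpos h'.le h.le)) (one_div_neg.mpr h').le
  · have hba : b ≤ a := (div_le_div_right_of_neg h).mp hab
    exact mul_le_mul_of_nonneg_left
      (Real.rpow_le_rpow_of_nonpos hb hba (div_nonpos_of_nonneg_of_nonpos h'.le h.le))
      (one_div_pos.mpr h').le
  · have hba : a ≤ b := (div_le_div_iff_of_pos_right h).mp hab
    exact mul_le_mul_of_nonpos_left
      (Real.rpow_le_rpow_of_nonpos ha hba (div_nonpos_of_nonpos_of_nonneg h'.le h.le))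
      (one_div_neg.mpr h').le
  · have hba : a ≤ b := (div_le_div_iff_of_pos_right h).mp hab
    exact mul_le_mul_of_nonneg_left
      (Real.rpow_le_rpow ha.le hba (div_nonneg h'.le h.le)) (one_div_pos.mpr h').le

theorem setIntegral_dirac_add_withDensity {D τ t : ℝ} (hD : 0 ≤ D) (hτ : 0 ≤ τ) (ht : 0 ≤ t)
    {φ κ : ℝ → ℝ} (hφ : Continuous φ) (hκ : Continuous κ) (hκ0 : ∀ s, 0 ≤ κ s) :
    ∫ s in Icc 0 t, φ s ∂(ENNReal.ofReal D • Measure.dirac 0 +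
        (volume.restrict (Ioc 0 τ)).withDensity (fun s => ENNReal.ofReal (κ s))) =
      D * φ 0 + ∫ s in (0:ℝ)..min t τ, φ s * κ s := by
  have hmeas : Measurable fun s => ENNReal.ofReal (κ s) := hκ.measurable.ennreal_ofReal
  have hlt : ∀ s, ENNReal.ofReal (κ s) < ⊤ := fun s => ENNReal.ofReal_lt_top
  have hset : Icc 0 t ∩ Ioc 0 τ = Ioc 0 (min t τ) := by
    ext x; simp only [mem_inter_iff, mem_Icc, mem_Ioc, le_min_iff]
    constructor
    · rintro ⟨⟨_, h2⟩, h3, h4⟩; exact ⟨h3, h2, h4⟩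
    · rintro ⟨h3, h2, h4⟩; exact ⟨⟨h3.le, h2⟩, h3, h4⟩
  have h0 : (0:ℝ) ∈ Icc 0 t := ⟨le_rfl, ht⟩
  rw [Measure.restrict_add, Measure.restrict_smul, restrict_withDensity measurableSet_Icc,
    Measure.restrict_restrict measurableSet_Icc, hset, restrict_dirac, if_pos h0,
    integral_add_measure, integral_smul_measure, integral_dirac,
    integral_withDensity_eq_integral_toReal_smul hmeas (ae_of_all _ hlt),
    intervalIntegral.integral_of_le (le_min ht hτ), ENNReal.toReal_ofReal hD, smul_eq_mul]
  · congr 1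
    refine integral_congr_ae (ae_of_all _ fun s => ?_)
    simp only [smul_eq_mul, ENNReal.toReal_ofReal (hκ0 s), mul_comm]
  · exact (integrable_dirac (by simp)).smul_measure ENNReal.ofReal_ne_top
  · rw [integrable_withDensity_iff_integrable_smul' hmeas (ae_of_all _ hlt)]
    simp only [smul_eq_mul, ENNReal.toReal_ofReal (hκ0 _)]
    exact ((hκ.mul hφ).integrableOn_Icc (a := 0) (b := min t τ)).mono_set Ioc_subset_Icc_self

theorem integral_mul_setIntegral_Icc_swap {T : ℝ} (hT : 0 ≤ T) (μ : Measure ℝ)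
    [IsFiniteMeasure μ] {g k : ℝ → ℝ} (hg : Continuous g) (hk : Continuous k) :
    ∫ s in (0:ℝ)..T, g s * ∫ u in Icc 0 s, k u ∂μ =
      ∫ u in Icc 0 T, k u * (∫ s in u..T, g s) ∂μ := by
  have hS : MeasurableSet {p : ℝ × ℝ | p.2 ≤ p.1} := measurableSet_le measurable_snd measurable_fst
  have hint : Integrable (Function.uncurry fun s u : ℝ =>
      (indicator {p : ℝ × ℝ | p.2 ≤ p.1} (fun p => g p.1 * k p.2)) (s, u))
      ((volume.restrict (Ioc 0 T)).prod (μ.restrict (Icc 0 T))) := by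
    refine Integrable.indicator ?_ hS
    exact Integrable.mul_prod (μ := volume.restrict (Ioc 0 T)) (ν := μ.restrict (Icc 0 T))
      (hg.integrableOn_Ioc) (hk.integrableOn_Icc)
  have hswap := integral_integral_swap hint
  rw [intervalIntegral.integral_of_le hT]
  convert hswap using 1
  · refine setIntegral_congr_fun measurableSet_Ioc fun s hs => ?_
    have : (fun u => indicator {p : ℝ × ℝ | p.2 ≤ p.1} (fun p => g p.1 * k p.2) (s, u)) =
        indicator (Iic s) (fun u => g s * k u) := by
      ext u; simp [indicator]
    simp only [this]
    rw [integral_indicator measurableSet_Iic, Measure.restrict_restrict measurableSet_Iic,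
      integral_const_mul]
    congr 4
    ext x; simp only [mem_Icc, mem_inter_iff, mem_Iic]
    constructor
    · rintro ⟨h1, h2⟩; exact ⟨h2, h1, h2.trans hs.2⟩
    · rintro ⟨h1, h2, _⟩; exact ⟨h2, h1⟩
  · refine setIntegral_congr_fun measurableSet_Icc fun u hu => ?_
    have : (fun s => indicator {p : ℝ × ℝ | p.2 ≤ p.1} (fun p => g p.1 * k p.2) (s, u)) =
        indicator (Ici u) (fun s => k u * g s) := by
      ext s; simp [indicator, mul_comm]
    simp only [this]
    rw [integral_indicator measurableSet_Ici, Measure.restrict_restrict measurableSet_Ici,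
      integral_const_mul, intervalIntegral.integral_of_le hu.2]
    congr 1
    refine setIntegral_congr_set ?_
    have h1 : (Ioc u T : Set ℝ) =ᵐ[volume] Icc u T := Ioc_ae_eq_Icc
    have h2 : (Ici u ∩ Ioc 0 T : Set ℝ) =ᵐ[volume] (Ici u ∩ Icc 0 T : Set ℝ) :=
      (Filter.EventuallyEq.refl _ _).inter (Ioc_ae_eq_Icc (a := (0:ℝ)) (b := T))
    have h3 : Ici u ∩ Icc 0 T = Icc u T := by
      ext x; simp only [mem_Icc, mem_inter_iff, mem_Ici]
      constructor
      · rintro ⟨h1, _, h2⟩; exact ⟨h1, h2⟩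
      · rintro ⟨h1, h2⟩; exact ⟨h1, hu.1.trans h1, h2⟩
    rw [h3] at h2
    exact h1.trans h2.symm

theorem satisfactionExp_eq_exp_mul {T : ℝ} (y β : ℝ) (C : ConsumptionPlan T) (s : ℝ) :
    satisfactionExp y β C s =
      Real.exp (-β * s) * (y + β * ∫ u in Icc 0 s, Real.exp (β * u) ∂C.μ) := by
  have h : ∫ u in Icc 0 s, Real.exp (-β * (s - u)) ∂C.μ =
      Real.exp (-β * s) * ∫ u in Icc 0 s, Real.exp (β * u) ∂C.μ := by
    rw [← integral_const_mul]
    congr 1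
    ext u
    rw [← Real.exp_add]
    ring_nf
  rw [satisfactionExp, h]
  ring

theorem monotone_setIntegral_Icc_exp (β : ℝ) (μ : Measure ℝ) [IsFiniteMeasure μ] :
    Monotone fun s : ℝ => ∫ u in Icc 0 s, Real.exp (β * u) ∂μ := by
  intro a b hab
  have hc : Continuous fun u : ℝ => Real.exp (β * u) := by fun_prop
  exact setIntegral_mono_set hc.integrableOn_Icc (ae_of_all _ fun u => (Real.exp_pos _).le)
    (Icc_subset_Icc_right hab).eventuallyLE

theorem measurable_satisfactionExp {T : ℝ} (y β : ℝ) (C : ConsumptionPlan T) :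
    Measurable fun s => satisfactionExp y β C s := by
  have := C.fin
  have h := (monotone_setIntegral_Icc_exp β C.μ).measurable
  simp only [satisfactionExp_eq_exp_mul]
  exact (by fun_prop : Measurable fun s : ℝ => Real.exp (-β * s)).mul
    ((h.const_mul β).const_add y)

theorem exists_satisfactionExp_mem_Icc {T y β : ℝ} (hβ : 0 < β) (hy : 0 < y)
    (C : ConsumptionPlan T) :
    ∃ m M : ℝ, 0 < m ∧ ∀ s ∈ Icc 0 T, satisfactionExp y β C s ∈ Icc m M := by
  have := C.fin
  refine ⟨y * Real.exp (-β * T), y + β * ∫ u in Icc 0 T, Real.exp (β * u) ∂C.μ,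
    by positivity, fun s hs => ?_⟩
  have hmono := monotone_setIntegral_Icc_exp β C.μ hs.2
  have hnn : 0 ≤ ∫ u in Icc 0 s, Real.exp (β * u) ∂C.μ :=
    integral_nonneg fun u => (Real.exp_pos _).le
  rw [satisfactionExp_eq_exp_mul]
  have hexp1 : Real.exp (-β * T) ≤ Real.exp (-β * s) :=
    Real.exp_le_exp.mpr (by nlinarith [hs.2])
  have hexp2 : Real.exp (-β * s) ≤ 1 := Real.exp_le_one_iff.mpr (by nlinarith [hs.1])
  constructor
  · rw [mul_comm y]
    exact mul_le_mul hexp1 (le_add_of_nonneg_right (by positivity)) hy.le (Real.exp_pos _).le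
  · calc _ ≤ 1 * (y + β * ∫ u in Icc 0 s, Real.exp (β * u) ∂C.μ) :=
          mul_le_mul_of_nonneg_right hexp2 (by positivity)
      _ ≤ _ := by
          rw [one_mul]
          exact add_le_add_right (mul_le_mul_of_nonneg_left hmono hβ.le) y

theorem intervalIntegrable_mul_of_bounded {T K : ℝ} (hT : 0 ≤ T) {g f : ℝ → ℝ}
    (hg : Continuous g) (hf : Measurable f) (hK : ∀ s ∈ Icc 0 T, |f s| ≤ K) :
    IntervalIntegrable (fun s => g s * f s) volume 0 T := by
  rw [intervalIntegrable_iff_integrableOn_Ioc_of_le hT]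
  refine Integrable.mul_bdd (c := K) hg.integrableOn_Ioc hf.aestronglyMeasurable ?_
  refine (ae_restrict_iff' measurableSet_Ioc).mpr (ae_of_all _ fun s hs => ?_)
  exact hK s ⟨hs.1.le, hs.2⟩

theorem intervalIntegrable_mul_satisfactionExp {T y β : ℝ} (hT : 0 ≤ T) (hβ : 0 < β)
    (hy : 0 < y) (C : ConsumptionPlan T) {g : ℝ → ℝ} (hg : Continuous g) :
    IntervalIntegrable (fun s => g s * satisfactionExp y β C s) volume 0 T := by
  obtain ⟨m, M, hm, hmM⟩ := exists_satisfactionExp_mem_Icc hβ hy C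
  refine intervalIntegrable_mul_of_bounded (K := M) hT hg (measurable_satisfactionExp y β C)
    fun s hs => ?_
  rw [abs_of_pos (hm.trans_le (hmM s hs).1)]
  exact (hmM s hs).2

theorem intervalIntegrable_mul_satisfactionExp_rpow {T y β γ : ℝ} (hT : 0 ≤ T) (hβ : 0 < β)
    (hy : 0 < y) (C : ConsumptionPlan T) {g : ℝ → ℝ} (hg : Continuous g) :
    IntervalIntegrable (fun s => g s * satisfactionExp y β C s ^ γ) volume 0 T := by
  obtain ⟨m, M, hm, hmM⟩ := exists_satisfactionExp_mem_Icc hβ hy C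
  refine intervalIntegrable_mul_of_bounded (K := max (m ^ γ) (M ^ γ)) hT hg
    ((measurable_satisfactionExp y β C).pow_const γ) fun s hs => ?_
  have h0 := hm.trans_le (hmM s hs).1
  rw [abs_of_pos (Real.rpow_pos_of_pos h0 γ)]
  rcases le_total 0 γ with h | h
  · exact le_max_of_le_right (Real.rpow_le_rpow h0.le (hmM s hs).2 h)
  · exact le_max_of_le_left (Real.rpow_le_rpow_of_nonpos hm (hmM s hs).1 h)

theorem integral_mul_satisfactionExp {T y β : ℝ} (hT : 0 ≤ T) (hβ : 0 < β) (hy : 0 < y)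
    (C : ConsumptionPlan T) {g : ℝ → ℝ} (hg : Continuous g) :
    ∫ s in (0:ℝ)..T, g s * Real.exp (β * s) * satisfactionExp y β C s =
      y * (∫ s in (0:ℝ)..T, g s) +
        ∫ u in Icc 0 T, β * Real.exp (β * u) * (∫ s in u..T, g s) ∂C.μ := by
  have := C.fin
  have hswap := integral_mul_setIntegral_Icc_swap hT C.μ hg
    (by fun_prop : Continuous fun u : ℝ => Real.exp (β * u))
  have heq : ∀ s, g s * Real.exp (β * s) * satisfactionExp y β C s =
      y * g s + β * (g s * ∫ u in Icc 0 s, Real.exp (β * u) ∂C.μ) := by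
    intro s
    have h1 : Real.exp (β * s) * Real.exp (-β * s) = 1 := by
      rw [← Real.exp_add]; simp
    rw [satisfactionExp_eq_exp_mul]
    linear_combination (g s * (y + β * ∫ u in Icc 0 s, Real.exp (β * u) ∂C.μ)) * h1
  have hi1 : IntervalIntegrable (fun s => y * g s) volume 0 T :=
    (hg.intervalIntegrable _ _).const_mul y
  have hi2 : IntervalIntegrable
      (fun s => β * (g s * ∫ u in Icc 0 s, Real.exp (β * u) ∂C.μ)) volume 0 T := by
    have h := (intervalIntegrable_mul_satisfactionExp hT hβ hy C
      (hg.mul (by fun_prop : Continuous fun s : ℝ => Real.exp (β * s)))).sub hi1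
    refine h.congr fun s _ => ?_
    have := heq s
    simp only [Pi.mul_apply]
    linarith
  simp only [heq]
  rw [intervalIntegral.integral_add hi1 hi2, intervalIntegral.integral_const_mul,
    intervalIntegral.integral_const_mul, hswap, ← integral_const_mul]
  simp only [mul_assoc]

theorem continuous_integral_left {g : ℝ → ℝ} (hg : Continuous g) (T : ℝ) :
    Continuous fun u => ∫ s in u..T, g s := by
  simp only [intervalIntegral.integral_symm T]
  exact (intervalIntegral.continuous_primitive (fun a b => hg.intervalIntegrable a b) T).neg

/-- Sufficiency of the first-order conditions: if the marginal utility of consumption along `D`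
is dominated by a multiple `M` of the price, with equality of the corresponding integrals
against `dD`, then `D` is at least as good as every plan in the budget set. -/
theorem ezUtility_le_of_firstOrderConditions {T w r β y δ α ρ M : ℝ} (hT : 0 < T) (hβ : 0 < β)
    (hy : 0 < y) (hδ : 0 < δ) (hρ1 : ρ ≠ 1) (hα0 : 0 < α) (hα1 : 1/α ≠ 1) (hM : 0 ≤ M)
    (C D : ConsumptionPlan T) {g : ℝ → ℝ} (hg : Continuous g)
    (hgD : ∀ s ∈ Icc 0 T,
      Real.exp (-δ * s) * satisfactionExp y β D s ^ (-(1/α)) = g s * Real.exp (β * s))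
    (hle : ∀ u ∈ Icc 0 T, β * Real.exp (β * u) * (∫ s in u..T, g s) ≤ M * Real.exp (-r * u))
    (heq : ∫ u in Icc 0 T, β * Real.exp (β * u) * (∫ s in u..T, g s) ∂D.μ = M * w)
    (hC : InBudget w (fun t => Real.exp (-r * t)) C) :
    ezUtility T δ α ρ y β C 0 ≤ ezUtility T δ α ρ y β D 0 := by
  have := C.fin
  set γ := 1 - 1/α with hγ
  have hγ0 : γ ≠ 0 := sub_ne_zero.mpr hα1.symm
  have hγ1 : γ ≤ 1 := by have : 0 < 1/α := by positivity
                         linarith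
  have hpos : ∀ (E : ConsumptionPlan T), ∀ s ∈ Icc 0 T, 0 < satisfactionExp y β E s := by
    intro E s hs
    obtain ⟨m, M', hm, h⟩ := exists_satisfactionExp_mem_Icc hβ hy E
    exact hm.trans_le (h s hs).1
  have hcδ : Continuous fun s : ℝ => δ * Real.exp (δ * (0 - s)) := by fun_prop
  have hint : ∀ E : ConsumptionPlan T, IntervalIntegrable
      (fun s => δ * Real.exp (δ * (0 - s)) * satisfactionExp y β E s ^ γ) volume 0 T :=
    fun E => intervalIntegrable_mul_satisfactionExp_rpow hT.le hβ hy E hcδ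
  have hJpos : ∀ E : ConsumptionPlan T,
      0 < ∫ s in (0:ℝ)..T, δ * Real.exp (δ * (0 - s)) * satisfactionExp y β E s ^ γ := by
    intro E
    refine intervalIntegral.intervalIntegral_pos_of_pos_on (hint E) (fun s hs => ?_) hT
    have := Real.rpow_pos_of_pos (hpos E s (Ioo_subset_Icc_self hs)) γ
    positivity
  refine one_div_mul_rpow_div_le (hJpos C) (hJpos D) (sub_ne_zero.mpr hρ1.symm) hγ0 ?_
  have hcg : Continuous fun s => g s * Real.exp (β * s) := by fun_prop
  have hgi : ∀ E : ConsumptionPlan T, IntervalIntegrable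
      (fun s => g s * Real.exp (β * s) * satisfactionExp y β E s) volume 0 T :=
    fun E => intervalIntegrable_mul_satisfactionExp hT.le hβ hy E hcg
  have hcφ : Continuous fun u => β * Real.exp (β * u) * ∫ s in u..T, g s :=
    (by fun_prop : Continuous fun u : ℝ => β * Real.exp (β * u)).mul
      (continuous_integral_left hg T)
  have hcost : ∫ u in Icc 0 T, β * Real.exp (β * u) * (∫ s in u..T, g s) ∂C.μ ≤ M * w := by
    have hcr : Continuous fun u : ℝ => M * Real.exp (-r * u) := by fun_prop
    refine (setIntegral_mono_on hcφ.integrableOn_Icc hcr.integrableOn_Icc measurableSet_Icc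
      hle).trans ?_
    rw [integral_const_mul]
    exact mul_le_mul_of_nonneg_left hC hM
  have hlin : (∫ s in (0:ℝ)..T, g s * Real.exp (β * s) * satisfactionExp y β C s) ≤
      ∫ s in (0:ℝ)..T, g s * Real.exp (β * s) * satisfactionExp y β D s := by
    rw [integral_mul_satisfactionExp hT.le hβ hy C hg,
      integral_mul_satisfactionExp hT.le hβ hy D hg, heq]
    linarith
  have hmain := intervalIntegral.integral_mono_on hT.le ((hint C).div_const γ)
    (((hint D).div_const γ).add (((hgi C).sub (hgi D)).const_mul δ)) (fun s hs => ?_)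
  · rw [intervalIntegral.integral_add ((hint D).div_const γ)
      (((hgi C).sub (hgi D)).const_mul δ), intervalIntegral.integral_const_mul,
      intervalIntegral.integral_sub (hgi C) (hgi D), intervalIntegral.integral_div,
      intervalIntegral.integral_div] at hmain
    have := mul_nonneg hδ.le (sub_nonneg.mpr hlin)
    linarith
  · have hconc := rpow_div_le_add_rpow_sub_one_mul (hpos C s hs) (hpos D s hs) hγ0 hγ1
    have hexp : Real.exp (δ * (0 - s)) = Real.exp (-δ * s) := by ring_nf
    have hγα : γ - 1 = -(1/α) := by rw [hγ]; ring
    have hfoc := hgD s hs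
    rw [← hγα] at hfoc
    have hmul := mul_le_mul_of_nonneg_left hconc
      (mul_nonneg hδ.le (Real.exp_pos (-δ * s)).le)
    rw [hexp]
    calc _ = δ * Real.exp (-δ * s) * (satisfactionExp y β C s ^ γ / γ) := by ring
      _ ≤ _ := hmul
      _ = _ := by
        linear_combination (δ * (satisfactionExp y β C s - satisfactionExp y β D s)) * hfoc

/-- Epstein–Zin explicit solution, case of large wealth `w ≥ k* y`: the plan with an
initial gulp `ΔC₀ = (w − k*y)/(1+βk*)` at time `0`, consumption at rates
`dC_t = (1 − α(δ−r)/β)((y+βw)/(1+βk*)) e^{−α(δ−r)t} dt` on `(0, τ̄]`, and no consumption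
afterwards, is optimal for `sup_{C ∈ A(w)} U^C_0`. -/
theorem epstein_zin_optimal_plan_large_wealth
    (T w r β y δ α ρ : ℝ)
    (hT : 0 < T) (hw : 0 < w) (hr : 0 ≤ r) (hβ : 0 < β) (hy : 0 < y)
    (hδ : 0 < δ) (hρ0 : 0 < ρ) (hρ1 : ρ ≠ 1) (hα0 : 0 < α) (hα1 : 1/α ≠ 1)
    (hρα : ρ < 1/α) (hrate : 0 < r + β/α - δ)
    (htau : 0 < tauBar T r β δ α)
    (hwk : kStar T r β δ α * y ≤ w)
    (Cstar : ConsumptionPlan T)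
    (hCstar : Cstar.μ =
      ENNReal.ofReal ((w - kStar T r β δ α * y) / (1 + β * kStar T r β δ α)) •
          Measure.dirac 0 +
        (volume.restrict (Set.Ioc 0 (tauBar T r β δ α))).withDensity
          (fun t => ENNReal.ofReal
            ((1 - α * (δ - r) / β) * ((y + β * w) / (1 + β * kStar T r β δ α)) *
              Real.exp (-(α * (δ - r)) * t)))) :
    InBudget w (fun t => Real.exp (-r * t)) Cstar ∧
      ∀ C : ConsumptionPlan T, InBudget w (fun t => Real.exp (-r * t)) C →
        ezUtility T δ α ρ y β C 0 ≤ ezUtility T δ α ρ y β Cstar 0 := by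
  have hβα : 0 < β / α := by positivity
  set τ := tauBar T r β δ α with hτ
  set k := kStar T r β δ α with hk
  set c := 1 - α * (δ - r) / β with hc
  set A := (y + β * w) / (1 + β * k) with hA
  set D := (w - k * y) / (1 + β * k) with hD
  have hτT : τ < T := tauBar_lt hr hβ hrate
  have hq : 0 < r + β := by positivity
  have hβc : β * c = α * (r + β/α - δ) := by rw [hc]; field_simp; ring
  have hc0 : 0 < c := by
    have : 0 < β * c := hβc ▸ by positivity
    exact (mul_pos_iff_of_pos_left hβ).mp this
  have hkint : k = c * ∫ s in (0:ℝ)..τ, Real.exp (-(α * δ + (1 - α) * r) * s) :=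
    kStar_eq_integral hβ hα0
  have hk0 : 0 ≤ k := by
    rw [hkint]
    exact mul_nonneg hc0.le
      (intervalIntegral.integral_nonneg htau.le fun s _ => (Real.exp_pos _).le)
  have hk1 : 0 < 1 + β * k := by positivity
  have hA0 : 0 < A := by positivity
  have hD0 : 0 ≤ D := div_nonneg (by linarith) hk1.le
  have hyD : y + β * D = A := by rw [hA, hD]; field_simp; ring
  have hAk : D + A * k = w := by rw [hA, hD]; field_simp; ring
  have hrate_cont : Continuous fun s : ℝ => c * A * Real.exp (-(α * (δ - r)) * s) := by fun_prop
  have hCint : ∀ {t : ℝ}, 0 ≤ t → ∀ {φ : ℝ → ℝ}, Continuous φ →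
      ∫ s in Icc 0 t, φ s ∂Cstar.μ = D * φ 0 +
        ∫ s in (0:ℝ)..min t τ, φ s * (c * A * Real.exp (-(α * (δ - r)) * s)) := by
    intro t ht φ hφ
    rw [hCstar]
    exact setIntegral_dirac_add_withDensity hD0 htau.le ht hφ hrate_cont
      fun s => by positivity
  have hcost : ∫ s in Icc 0 T, Real.exp (-r * s) ∂Cstar.μ = w := by
    rw [hCint hT.le (by fun_prop), min_eq_right hτT.le]
    have : ∀ s : ℝ, Real.exp (-r * s) * (c * A * Real.exp (-(α * (δ - r)) * s)) =
        A * c * Real.exp (-(α * δ + (1 - α) * r) * s) := by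
      intro s
      have : -(α * δ + (1 - α) * r) * s = -r * s + -(α * (δ - r)) * s := by ring
      rw [this, Real.exp_add]
      ring
    simp only [this]
    rw [intervalIntegral.integral_const_mul, mul_assoc, ← hkint, mul_zero, Real.exp_zero, mul_one,
      hAk]
  have hY : ∀ s ∈ Icc 0 T, satisfactionExp y β Cstar s =
      A * Real.exp (-β * s + β * c * min s τ) := by
    intro s hs
    have hint : ∫ u in (0:ℝ)..min s τ,
        Real.exp (β * u) * (c * A * Real.exp (-(α * (δ - r)) * u)) =
          c * A * ((Real.exp (β * c * min s τ) - 1) / (β * c)) := by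
      have h := integral_exp_const_mul (mul_pos hβ hc0).ne' 0 (min s τ)
      rw [mul_zero, Real.exp_zero] at h
      rw [← h,
        ← intervalIntegral.integral_const_mul]
      congr 1
      ext u
      have : β * c * u = β * u + -(α * (δ - r)) * u := by rw [hc]; field_simp; ring
      rw [this, Real.exp_add]
      ring
    rw [satisfactionExp_eq_exp_mul, hCint hs.1 (by fun_prop), hint, mul_zero, Real.exp_zero,
      Real.exp_add]
    have : β * (c * A * ((Real.exp (β * c * min s τ) - 1) / (β * c))) =
        A * Real.exp (β * c * min s τ) - A := by field_simp
    linear_combination Real.exp (-β * s) * this + Real.exp (-β * s) * hyD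
  refine ⟨hcost.le, fun C hC => ?_⟩
  set κ := δ + β * (1 - 1/α) with hκ
  set p := r + β/α - δ with hp
  have hκp : κ + p = r + β := by rw [hκ, hp]; ring
  set B := A ^ (-(1/α)) with hB
  have hB0 : 0 < B := Real.rpow_pos_of_pos hA0 _
  set g : ℝ → ℝ := fun s => Real.exp (-κ * s + -p * min s τ) with hg
  have hgc : Continuous g := by fun_prop
  have hgle : ∀ {s : ℝ}, s ≤ τ → g s = Real.exp (-(r + β) * s) := by
    intro s hs
    simp only [hg, min_eq_left hs, ← hκp]
    ring_nf
  have hexpc : Continuous fun s : ℝ => Real.exp (-(r + β) * s) := by fun_prop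
  have htail : ∫ s in τ..T, g s = Real.exp (-(r + β) * τ) / (r + β) := by
    have h1 : ∫ s in τ..T, g s = ∫ s in τ..T, Real.exp (-p * τ) * Real.exp (-κ * s) := by
      refine intervalIntegral.integral_congr fun s hs => ?_
      rw [uIcc_of_le hτT.le] at hs
      simp only [hg, min_eq_right hs.1, ← Real.exp_add]
      ring_nf
    rw [h1, intervalIntegral.integral_const_mul, integral_exp_tauBar hr hβ hrate, ← hτ, ← hκ, ← mul_div_assoc,
      ← Real.exp_add, ← hκp]
    ring_nf
  have hexpint : ∀ u, ∫ s in u..τ, Real.exp (-(r + β) * s) =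
      Real.exp (-(r + β) * u) / (r + β) - Real.exp (-(r + β) * τ) / (r + β) := by
    intro u
    rw [integral_exp_const_mul (neg_ne_zero.mpr hq.ne')]
    field_simp
    ring
  have hGeq : ∀ u ≤ τ, ∫ s in u..T, g s = Real.exp (-(r + β) * u) / (r + β) := by
    intro u hu
    have h1 : ∫ s in u..τ, g s = ∫ s in u..τ, Real.exp (-(r + β) * s) := by
      refine intervalIntegral.integral_congr fun s hs => ?_
      rw [uIcc_of_le hu] at hs
      exact hgle hs.2
    rw [← intervalIntegral.integral_add_adjacent_intervals (hgc.intervalIntegrable u τ)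
      (hgc.intervalIntegrable τ T), h1, hexpint, htail]
    ring
  have hGle : ∀ u, ∫ s in u..T, g s ≤ Real.exp (-(r + β) * u) / (r + β) := by
    intro u
    rcases le_total u τ with hu | hu
    · exact (hGeq u hu).le
    · have h1 : ∫ s in τ..u, Real.exp (-(r + β) * s) ≤ ∫ s in τ..u, g s := by
        refine intervalIntegral.integral_mono_on hu (hexpc.intervalIntegrable _ _)
          (hgc.intervalIntegrable _ _) fun s hs => ?_
        simp only [hg, min_eq_right hs.1, ← hκp]
        exact Real.exp_le_exp.mpr (by nlinarith [hs.1])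
      have h2 := intervalIntegral.integral_add_adjacent_intervals
        (μ := volume) (hgc.intervalIntegrable τ u) (hgc.intervalIntegrable u T)
      rw [intervalIntegral.integral_symm, hexpint] at h1
      linarith only [h1, h2, htail]
  have hprice : ∀ u : ℝ, β * Real.exp (β * u) * (B * (Real.exp (-(r + β) * u) / (r + β))) =
      β * B / (r + β) * Real.exp (-r * u) := by
    intro u
    have : -r * u = β * u + -(r + β) * u := by ring
    rw [this, Real.exp_add]
    ring
  have hφc : Continuous fun u : ℝ => β * Real.exp (β * u) * ∫ s in u..T, B * g s :=
    (by fun_prop : Continuous fun u : ℝ => β * Real.exp (β * u)).mul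
      (continuous_integral_left (hgc.const_mul B) T)
  refine ezUtility_le_of_firstOrderConditions (M := β * B / (r + β)) (g := fun s => B * g s)
    hT hβ hy hδ hρ1 hα0 hα1 (by positivity) C Cstar (hgc.const_mul B) (fun s hs => ?_)
    (fun u hu => ?_) ?_ hC
  · rw [hY s hs, Real.mul_rpow hA0.le (Real.exp_pos _).le, ← hB, ← Real.exp_mul, mul_left_comm,
      ← Real.exp_add, hβc]
    simp only [hg]
    rw [mul_assoc B, ← Real.exp_add]
    congr 2
    rw [hκ]
    field_simp
    ring
  · rw [intervalIntegral.integral_const_mul, ← hprice]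
    have := hGle u
    gcongr
  · rw [← hcost, ← integral_const_mul, hCint hT.le hφc, hCint hT.le (by fun_prop)]
    simp only [intervalIntegral.integral_const_mul, hGeq 0 htau.le, hprice]
    congr 1
    refine intervalIntegral.integral_congr fun u hu => ?_
    rw [min_eq_right hτT.le, uIcc_of_le htau.le] at hu
    simp only [hGeq u hu.2, hprice]
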